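/- Let U₁,…,U_D be unitary N×N complex matrices, let E be the superoperator E(X) = (1/D)·Σ_{d=1}^{D} U_d·X·U_d†, and let ρ be an N×N density matrix. Then the von Neumann entropies satisfy S(E(ρ)) ≤ S(ρ) + log₂ D. -/

import Mathlib

open scoped Matrix ComplexOrder

/-- The von Neumann entropy (in bits) of a Hermitian matrix: the Shannon entropy of its
eigenvalue distribution (zero eigenvalues contribute `0`). -/
noncomputable def vonNeumannEntropy {n : Type*} [Fintype n] [DecidableEq n]
    (A : Matrix n n ℂ) : ℝ :=
  if h : A.IsHermitian then ∑ i, h.eigenvalues i * Real.logb 2 (h.eigenvalues i)⁻¹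
  else 0

/-- If `C diag(p) C† = diag(μ)`, then the two associated quadratic forms agree. -/
theorem sum_mul_normSq_conjTranspose_mulVec {ι κ : Type*} [Fintype ι] [Fintype κ]
    [DecidableEq ι] [DecidableEq κ] {C : Matrix ι κ ℂ} {p : κ → ℝ} {μ : ι → ℝ}
    (h : C * Matrix.diagonal (fun k => (p k : ℂ)) * Cᴴ = Matrix.diagonal fun i => (μ i : ℂ))
    (x : ι → ℂ) :
    ∑ k, p k * Complex.normSq ((Cᴴ *ᵥ x) k) = ∑ i, μ i * Complex.normSq (x i) := by
  have key : star (Cᴴ *ᵥ x) ⬝ᵥ (Matrix.diagonal (fun k => (p k : ℂ)) *ᵥ (Cᴴ *ᵥ x)) =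
      star x ⬝ᵥ (Matrix.diagonal (fun i => (μ i : ℂ)) *ᵥ x) := by
    rw [← h, Matrix.star_mulVec, Matrix.conjTranspose_conjTranspose, ← Matrix.dotProduct_mulVec,
      Matrix.mulVec_mulVec, Matrix.mulVec_mulVec, Matrix.mul_assoc]
  have hz (a : ℝ) (z : ℂ) : star z * (a * z) = ((a * Complex.normSq z : ℝ) : ℂ) := by
    rw [Complex.ofReal_mul, Complex.normSq_eq_conj_mul_self]
    simp only [Complex.star_def]
    ring
  simp only [dotProduct, Matrix.mulVec_diagonal, Pi.star_apply, hz] at key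
  exact_mod_cast key

/-- If `C diag(p) C† = diag(μ)` and `p ≥ 0`, then `p k • w w† ≤ diag(μ)` for the `k`-th column `w`
of `C`, which bounds the quadratic form of the inverse of `diag(μ)` at `w`. -/
theorem mul_sum_normSq_div_le_one {ι κ : Type*} [Fintype ι] [Fintype κ]
    [DecidableEq ι] [DecidableEq κ] {C : Matrix ι κ ℂ} {p : κ → ℝ} {μ : ι → ℝ}
    (h : C * Matrix.diagonal (fun k => (p k : ℂ)) * Cᴴ = Matrix.diagonal fun i => (μ i : ℂ))
    (hp : ∀ k, 0 ≤ p k) (hμ : ∀ i, 0 ≤ μ i) (k : κ) :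
    p k * ∑ i, Complex.normSq (C i k) / μ i ≤ 1 := by
  set t := ∑ i, Complex.normSq (C i k) / μ i with ht
  have ht0 : 0 ≤ t := Finset.sum_nonneg fun i _ => div_nonneg (Complex.normSq_nonneg _) (hμ i)
  have hq := sum_mul_normSq_conjTranspose_mulVec h fun i => C i k / μ i
  have hr : ∑ i, μ i * Complex.normSq (C i k / μ i) = t := by
    refine Finset.sum_congr rfl fun i _ => ?_
    rw [Complex.normSq_div, Complex.normSq_ofReal]
    rcases eq_or_ne (μ i) 0 with h0 | h0
    · simp [h0]
    · field_simp
  have hl : (Cᴴ *ᵥ fun i => C i k / μ i) k = (t : ℂ) := by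
    simp only [Matrix.mulVec, dotProduct, Matrix.conjTranspose_apply, ht, Complex.ofReal_sum,
      Complex.ofReal_div, Complex.normSq_eq_conj_mul_self, Complex.star_def, mul_div_assoc]
  have hle : p k * (t * t) ≤ t := by
    rw [hr] at hq
    rw [← Complex.normSq_ofReal t, ← hl]
    refine le_of_le_of_eq ?_ hq
    exact Finset.single_le_sum
      (f := fun k' => p k' * Complex.normSq ((Cᴴ *ᵥ fun i => C i k / μ i) k'))
      (fun k' _ => mul_nonneg (hp k') (Complex.normSq_nonneg _)) (Finset.mem_univ k)
  rcases ht0.eq_or_lt with h0 | h0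
  · simp [← h0]
  · exact le_of_mul_le_mul_right (by linarith) h0

/-- The spectrum `μ` of a mixture, with weights `p`, of pure states has Shannon entropy (in nats)
at most that of `p`; the columns of `C` are the pure states in an eigenbasis of the mixture. -/
theorem sum_negMulLog_le_of_mul_diagonal_mul_conjTranspose {ι κ : Type*} [Fintype ι] [Fintype κ]
    [DecidableEq ι] [DecidableEq κ] {C : Matrix ι κ ℂ} {p : κ → ℝ} {μ : ι → ℝ}
    (h : C * Matrix.diagonal (fun k => (p k : ℂ)) * Cᴴ = Matrix.diagonal fun i => (μ i : ℂ))
    (hC : ∀ k, ∑ i, Complex.normSq (C i k) = 1) (hp : ∀ k, 0 ≤ p k) :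
    ∑ i, Real.negMulLog (μ i) ≤ ∑ k, Real.negMulLog (p k) := by
  have hsum (i : ι) : ∑ k, p k * Complex.normSq (C i k) = μ i := by
    simpa [Matrix.mulVec_single, Pi.single_apply, apply_ite] using
      sum_mul_normSq_conjTranspose_mulVec h (Pi.single i 1)
  have hnonneg (i : ι) (k : κ) : 0 ≤ p k * Complex.normSq (C i k) :=
    mul_nonneg (hp k) (Complex.normSq_nonneg _)
  have hμ (i : ι) : 0 ≤ μ i := hsum i ▸ Finset.sum_nonneg fun k _ => hnonneg i k
  have hterm (i : ι) (k : κ) : p k * Complex.normSq (C i k) * (Real.log (p k) - Real.log (μ i)) ≤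
      p k * (p k * (Complex.normSq (C i k) / μ i)) - p k * Complex.normSq (C i k) := by
    rcases (hnonneg i k).eq_or_lt with h0 | h0
    · rcases mul_eq_zero.mp h0.symm with h1 | h1 <;> simp [h1]
    · have hpk : 0 < p k := (hp k).lt_of_ne fun h1 => by simp [← h1] at h0
      have hμi : 0 < μ i := h0.trans_le <| hsum i ▸
        Finset.single_le_sum (f := fun k => p k * Complex.normSq (C i k))
          (fun k _ => hnonneg i k) (Finset.mem_univ k)
      rw [← Real.log_div hpk.ne' hμi.ne']
      calc _ ≤ p k * Complex.normSq (C i k) * (p k / μ i - 1) :=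
            mul_le_mul_of_nonneg_left (Real.log_le_sub_one_of_pos (by positivity)) h0.le
        _ = _ := by ring
  have hp_sum : ∑ k, ∑ i, p k * Complex.normSq (C i k) * Real.log (p k) =
      -∑ k, Real.negMulLog (p k) := by
    rw [← Finset.sum_neg_distrib]
    refine Finset.sum_congr rfl fun k _ => ?_
    rw [← Finset.sum_mul, ← Finset.mul_sum, hC, Real.negMulLog]
    ring
  have hμ_sum : ∑ k, ∑ i, p k * Complex.normSq (C i k) * Real.log (μ i) =
      -∑ i, Real.negMulLog (μ i) := by
    rw [Finset.sum_comm, ← Finset.sum_neg_distrib]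
    refine Finset.sum_congr rfl fun i _ => ?_
    rw [← Finset.sum_mul, hsum, Real.negMulLog]
    ring
  have hle : ∑ k, ∑ i, p k * Complex.normSq (C i k) * (Real.log (p k) - Real.log (μ i)) ≤ 0 := by
    refine Finset.sum_nonpos fun k _ => (Finset.sum_le_sum fun i _ => hterm i k).trans ?_
    rw [Finset.sum_sub_distrib, ← Finset.mul_sum, ← Finset.mul_sum, ← Finset.mul_sum, hC]
    nlinarith [mul_le_mul_of_nonneg_left (mul_sum_normSq_div_le_one h hp hμ k) (hp k)]
  simp only [mul_sub, Finset.sum_sub_distrib, hp_sum, hμ_sum] at hle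
  linarith

theorem Matrix.IsHermitian.vonNeumannEntropy_eq {n : Type*} [Fintype n] [DecidableEq n]
    {A : Matrix n n ℂ} (hA : A.IsHermitian) :
    vonNeumannEntropy A = (∑ i, Real.negMulLog (hA.eigenvalues i)) / Real.log 2 := by
  rw [vonNeumannEntropy, dif_pos hA, Finset.sum_div]
  refine Finset.sum_congr rfl fun i _ => ?_
  rw [Real.logb_inv, Real.logb, Real.negMulLog]
  ring

theorem sum_normSq_col_eq_one {n : Type*} [Fintype n] [DecidableEq n] {A : Matrix n n ℂ}
    (hA : Aᴴ * A = 1) (j : n) : ∑ i, Complex.normSq (A i j) = 1 := by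
  have h := congrFun₂ hA j j
  simp only [Matrix.mul_apply, Matrix.conjTranspose_apply, Complex.star_def,
    ← Complex.normSq_eq_conj_mul_self, Matrix.one_apply_eq] at h
  exact_mod_cast h

theorem sum_negMulLog_div {ι : Type*} [Fintype ι] {p : ι → ℝ} (hp : ∑ i, p i = 1) {D : ℕ}
    (hD : 0 < D) :
    ∑ k : Fin D × ι, Real.negMulLog (p k.2 / D) =
      ∑ i, Real.negMulLog (p i) + Real.log D := by
  have hD' : (D : ℝ) ≠ 0 := by positivity
  have hterm (x : ℝ) : Real.negMulLog (x / D) = (Real.negMulLog x + x * Real.log D) / D := by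
    rw [div_eq_mul_inv, Real.negMulLog_mul]
    simp only [Real.negMulLog, Real.log_inv]
    ring
  simp only [Fintype.sum_prod_type, hterm, ← Finset.sum_div, Finset.sum_add_distrib,
    ← Finset.sum_mul, hp, Finset.sum_const, Finset.card_univ, Fintype.card_fin, nsmul_eq_mul]
  field_simp

/-- Placing the blocks `A d` side by side turns a sum of congruences into a single one. -/
theorem of_prod_mul_diagonal_mul_conjTranspose {ι n δ : Type*} [Fintype n] [Fintype δ]
    [DecidableEq n] [DecidableEq δ] (A : δ → Matrix ι n ℂ) (q : δ × n → ℂ) :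
    (Matrix.of fun i (k : δ × n) => A k.1 i k.2) * Matrix.diagonal q *
        (Matrix.of fun i (k : δ × n) => A k.1 i k.2)ᴴ =
      ∑ d, A d * Matrix.diagonal (fun j => q (d, j)) * (A d)ᴴ := by
  ext i j
  rw [Matrix.mul_apply, Matrix.sum_apply]
  simp only [Matrix.mul_apply (M := _ * Matrix.diagonal _), Matrix.mul_diagonal, Fintype.sum_prod_type,
    Matrix.conjTranspose_apply, Matrix.of_apply]

theorem Matrix.IsHermitian.exists_eq_mul_diagonal_eigenvalues_mul {n : Type*} [Fintype n]
    [DecidableEq n] {A : Matrix n n ℂ} (hA : A.IsHermitian) :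
    ∃ V : Matrix n n ℂ, Vᴴ * V = 1 ∧ V * Vᴴ = 1 ∧
      A = V * Matrix.diagonal (fun i => (hA.eigenvalues i : ℂ)) * Vᴴ :=
  ⟨hA.eigenvectorUnitary, Unitary.coe_star_mul_self _, Unitary.coe_mul_star_self _,
    hA.spectral_theorem⟩

/-- Let `U₁,…,U_D` be unitary `N×N` matrices,
`E(X) = (1/D)·Σ_d U_d·X·U_d†`, and `ρ` a density matrix.  Then
`S(E(ρ)) ≤ S(ρ) + log₂ D`. -/
theorem entropy_avg_unitary_conj_le {N D : ℕ} (hD : 0 < D)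
    (U : Fin D → Matrix (Fin N) (Fin N) ℂ)
    (hU : ∀ d, (U d)ᴴ * U d = 1)
    (ρ : Matrix (Fin N) (Fin N) ℂ) (hρ : ρ.PosSemidef) (htr : ρ.trace = 1) :
    vonNeumannEntropy ((D : ℂ)⁻¹ • ∑ d, U d * ρ * (U d)ᴴ) ≤
      vonNeumannEntropy ρ + Real.logb 2 D := by
  have hherm : ((D : ℂ)⁻¹ • ∑ d, U d * ρ * (U d)ᴴ).IsHermitian := by
    simp only [Matrix.IsHermitian, Matrix.conjTranspose_smul, Matrix.conjTranspose_sum,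
      Matrix.conjTranspose_mul, Matrix.conjTranspose_conjTranspose, hρ.isHermitian.eq, star_inv₀,
      star_natCast, Matrix.mul_assoc]
  obtain ⟨V, hV, hV', hσV⟩ := hherm.exists_eq_mul_diagonal_eigenvalues_mul
  obtain ⟨W, hW, -, hρW⟩ := hρ.isHermitian.exists_eq_mul_diagonal_eigenvalues_mul
  generalize hμ : hherm.eigenvalues = μ at hσV
  generalize hl : hρ.isHermitian.eigenvalues = l at hρW
  let C : Matrix (Fin N) (Fin D × Fin N) ℂ := Matrix.of fun i k => (Vᴴ * U k.1 * W) i k.2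
  have hcol (k : Fin D × Fin N) : ∑ i, Complex.normSq (C i k) = 1 := by
    refine sum_normSq_col_eq_one (A := Vᴴ * U k.1 * W) ?_ k.2
    calc _ = Wᴴ * ((U k.1)ᴴ * (V * Vᴴ) * U k.1) * W := by
          simp only [Matrix.conjTranspose_mul, Matrix.conjTranspose_conjTranspose,
            Matrix.mul_assoc]
      _ = 1 := by rw [hV', Matrix.mul_one, hU, Matrix.mul_one, hW]
  have hdiag : C * Matrix.diagonal (fun k : Fin D × Fin N => ((l k.2 / D : ℝ) : ℂ)) * Cᴴ =
      Matrix.diagonal fun i => (μ i : ℂ) := by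
    have hdiv : Matrix.diagonal (fun j => ((l j / D : ℝ) : ℂ)) =
        (D : ℂ)⁻¹ • Matrix.diagonal (fun j => (l j : ℂ)) := by
      rw [← Matrix.diagonal_smul]
      congr 1
      ext j
      simp [div_eq_inv_mul]
    calc _ = ∑ d, (Vᴴ * U d * W) * Matrix.diagonal (fun j => ((l j / D : ℝ) : ℂ)) *
          (Vᴴ * U d * W)ᴴ :=
          of_prod_mul_diagonal_mul_conjTranspose (fun d => Vᴴ * U d * W)
            fun k => ((l k.2 / D : ℝ) : ℂ)
      _ = (D : ℂ)⁻¹ • ∑ d, Vᴴ *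
          (U d * (W * Matrix.diagonal (fun j => (l j : ℂ)) * Wᴴ) * (U d)ᴴ) * V := by
          simp only [hdiv, Matrix.mul_smul, Matrix.smul_mul, ← Finset.smul_sum,
            Matrix.conjTranspose_mul, Matrix.conjTranspose_conjTranspose, Matrix.mul_assoc]
      _ = Vᴴ * ((D : ℂ)⁻¹ • ∑ d, U d * ρ * (U d)ᴴ) * V := by
          rw [← hρW, Matrix.mul_smul, Matrix.smul_mul, Finset.mul_sum, Finset.sum_mul]
      _ = (Vᴴ * V) * Matrix.diagonal (fun i => (μ i : ℂ)) * (Vᴴ * V) := by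
          rw [hσV]
          simp only [Matrix.mul_assoc]
      _ = _ := by rw [hV, Matrix.one_mul, Matrix.mul_one]
  subst hl hμ
  have hsum : ∑ j, hρ.isHermitian.eigenvalues j = 1 := by
    have h := hρ.isHermitian.trace_eq_sum_eigenvalues
    rw [htr, ← RCLike.ofReal_sum] at h
    exact Complex.ofReal_eq_one.mp h.symm
  have hle := sum_negMulLog_le_of_mul_diagonal_mul_conjTranspose hdiag hcol
    fun k => div_nonneg (hρ.eigenvalues_nonneg k.2) D.cast_nonneg
  rw [sum_negMulLog_div hsum hD] at hle
  rw [hherm.vonNeumannEntropy_eq, hρ.isHermitian.vonNeumannEntropy_eq, Real.logb, ← add_div]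
  exact div_le_div_of_nonneg_right hle (Real.log_nonneg one_le_two)
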